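/- Let T>0, let b∈C¹([0,T]) be nonnegative, let a∈𝒢^s(ℝ) (s>1) be nonnegative and let 0≤δ<1. Then for all k,l∈ℕ there exists C>0, independent of μ∈(0,1] and t∈[0,T], such that for all t∈[0,T], x,ξ∈ℝ and 0<μ≤1: |∂_x^{k}∂_ξ^{l}Λ(t,x,ξ)| ≤ C·Λ(t,x,ξ)·φ(x,ξ)^{-k/2}·⟨ξ⟩_μ^{-l}. -/

import Mathlib

open scoped ContDiff

open Set

/-- `⟨ξ⟩_μ = (μ⁻² + ξ²)^(1/2)` -/
noncomputable def br (μ ξ : ℝ) : ℝ := Real.sqrt (μ⁻¹ ^ 2 + ξ ^ 2)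

/-- `φ(x,ξ) = a(x) + ⟨ξ⟩_μ^(-2δ)` -/
noncomputable def phi (a : ℝ → ℝ) (δ μ x ξ : ℝ) : ℝ := a x + br μ ξ ^ (-(2*δ))

/-- Gevrey class `𝒢^s(ℝ)` -/
def Gevrey (s : ℝ) (a : ℝ → ℝ) : Prop :=
  ContDiff ℝ ∞ a ∧ ∃ C₀ A₀ : ℝ, 0 < C₀ ∧ 0 < A₀ ∧
    ∀ (x : ℝ) (k : ℕ), |iteratedDeriv k a x| ≤ C₀ * A₀ ^ k * (k.factorial : ℝ) ^ s

/-- `∂_x^k ∂_ξ^l f(x,ξ)` -/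
noncomputable def pdXxi (k l : ℕ) (f : ℝ → ℝ → ℝ) (x ξ : ℝ) : ℝ :=
  iteratedDeriv k (fun x' => iteratedDeriv l (f x') ξ) x

/-- `Λ(t,x,ξ) = ∫₀ᵗ |b'(σ)| φ(x,ξ) / (b(σ) φ(x,ξ) + ⟨ξ⟩_μ^(-2δ)) dσ`,
with `b'` the derivative of `b` within `[0,T]`. -/
noncomputable def Lam (b a : ℝ → ℝ) (T δ μ t x ξ : ℝ) : ℝ :=
  ∫ σ in (0:ℝ)..t,
    |derivWithin b (Icc 0 T) σ| * phi a δ μ x ξ /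
      (b σ * phi a δ μ x ξ + br μ ξ ^ (-(2*δ)))


/-- Functions of a parameter `i`, of `σ`, `x` and `ξ`. -/
abbrev Fn (I : Type) := I → ℝ → ℝ → ℝ → ℝ

def JCont {I : Type} (f : Fn I) : Prop :=
  ∀ i, Continuous fun q : ℝ × ℝ × ℝ => f i q.1 q.2.1 q.2.2

def Bdd {I : Type} (w f : Fn I) : Prop :=
  ∃ C : ℝ, 0 < C ∧ ∀ i σ x ξ, |f i σ x ξ| ≤ C * w i σ x ξ

/-- symbols of weight `w` up to order `n`: each `x`-derivative costs `X`, each `ξ`-derivative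
costs `Y`. -/
def SymW {I : Type} (X Y : I → ℝ → ℝ → ℝ) : ℕ → Fn I → Fn I → Prop
  | 0, w, f => JCont f ∧ Bdd w f
  | n + 1, w, f => JCont f ∧ Bdd w f ∧ ∃ fx fy : Fn I,
      (∀ i σ x ξ, HasDerivAt (fun x' => f i σ x' ξ) (fx i σ x ξ) x) ∧
      (∀ i σ x ξ, HasDerivAt (fun ξ' => f i σ x ξ') (fy i σ x ξ) ξ) ∧
      SymW X Y n (fun i σ x ξ => w i σ x ξ * X i x ξ) fx ∧
      SymW X Y n (fun i σ x ξ => w i σ x ξ * Y i x ξ) fy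

section SymLemmas

variable {I : Type} {X Y : I → ℝ → ℝ → ℝ}

theorem SymW.cont {n : ℕ} {w f : Fn I} (h : SymW X Y n w f) : JCont f := by
  cases n with
  | zero => exact h.1
  | succ n => exact h.1

theorem SymW.bdd {n : ℕ} {w f : Fn I} (h : SymW X Y n w f) : Bdd w f := by
  cases n with
  | zero => exact h.2
  | succ n => exact h.2.1

theorem Bdd.mono {w w' f : Fn I} (h : Bdd w f) (K : ℝ) (hK : 0 < K)
    (hw : ∀ i σ x ξ, w i σ x ξ ≤ K * w' i σ x ξ) : Bdd w' f := by
  obtain ⟨C, hC, hb⟩ := h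
  refine ⟨C * K, by positivity, fun i σ x ξ => (hb i σ x ξ).trans ?_⟩
  rw [mul_assoc]
  exact mul_le_mul_of_nonneg_left (hw i σ x ξ) hC.le

theorem SymW.mono (hX : ∀ i x ξ, 0 ≤ X i x ξ) (hY : ∀ i x ξ, 0 ≤ Y i x ξ) {n : ℕ} {w w' f : Fn I}
    (h : SymW X Y n w f) (K : ℝ) (hK : 0 < K)
    (hw : ∀ i σ x ξ, w i σ x ξ ≤ K * w' i σ x ξ) : SymW X Y n w' f := by
  induction n generalizing w w' f with
  | zero => exact ⟨h.1, h.2.mono K hK hw⟩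
  | succ n ih =>
    obtain ⟨hc, hb, fx, fy, hx, hy, sx, sy⟩ := h
    refine ⟨hc, hb.mono K hK hw, fx, fy, hx, hy, ih sx ?_, ih sy ?_⟩
    · intro i σ x ξ
      rw [← mul_assoc]
      exact mul_le_mul_of_nonneg_right (hw i σ x ξ) (hX i x ξ)
    · intro i σ x ξ
      rw [← mul_assoc]
      exact mul_le_mul_of_nonneg_right (hw i σ x ξ) (hY i x ξ)

theorem SymW.congr {n : ℕ} {w w' f f' : Fn I}
    (h : SymW X Y n w f) (hw : ∀ i σ x ξ, w i σ x ξ = w' i σ x ξ)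
    (hf : ∀ i σ x ξ, f i σ x ξ = f' i σ x ξ) : SymW X Y n w' f' := by
  have h1 : w = w' := by funext i σ x ξ; exact hw i σ x ξ
  have h2 : f = f' := by funext i σ x ξ; exact hf i σ x ξ
  rwa [← h1, ← h2]

theorem SymW.down {n : ℕ} {w f : Fn I} (h : SymW X Y (n + 1) w f) : SymW X Y n w f := by
  induction n generalizing w f with
  | zero => exact ⟨h.1, h.2.1⟩
  | succ n ih =>
    obtain ⟨hc, hb, fx, fy, hx, hy, sx, sy⟩ := h
    exact ⟨hc, hb, fx, fy, hx, hy, ih sx, ih sy⟩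

theorem SymW.add {n : ℕ} {w f g : Fn I} (hf : SymW X Y n w f) (hg : SymW X Y n w g) :
    SymW X Y n w (fun i σ x ξ => f i σ x ξ + g i σ x ξ) := by
  have hc : JCont (fun i σ x ξ => f i σ x ξ + g i σ x ξ) :=
    fun i => (hf.cont i).add (hg.cont i)
  have hb : Bdd w (fun i σ x ξ => f i σ x ξ + g i σ x ξ) := by
    obtain ⟨C, hC, h1⟩ := hf.bdd
    obtain ⟨C', hC', h2⟩ := hg.bdd
    refine ⟨C + C', by positivity, fun i σ x ξ => (abs_add_le _ _).trans ?_⟩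
    rw [add_mul]
    exact add_le_add (h1 _ _ _ _) (h2 _ _ _ _)
  induction n generalizing w f g with
  | zero => exact ⟨hc, hb⟩
  | succ n ih =>
    obtain ⟨_, _, fx, fy, hx, hy, sx, sy⟩ := hf
    obtain ⟨_, _, gx, gy, kx, ky, tx, ty⟩ := hg
    refine ⟨hc, hb, _, _, fun i σ x ξ => (hx i σ x ξ).add (kx i σ x ξ),
      fun i σ x ξ => (hy i σ x ξ).add (ky i σ x ξ), ih sx tx ?_ ?_, ih sy ty ?_ ?_⟩
    · exact fun i => (sx.cont i).add (tx.cont i)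
    · obtain ⟨C, hC, h1⟩ := sx.bdd
      obtain ⟨C', hC', h2⟩ := tx.bdd
      refine ⟨C + C', by positivity, fun i σ x ξ => (abs_add_le _ _).trans ?_⟩
      rw [add_mul]
      exact add_le_add (h1 _ _ _ _) (h2 _ _ _ _)
    · exact fun i => (sy.cont i).add (ty.cont i)
    · obtain ⟨C, hC, h1⟩ := sy.bdd
      obtain ⟨C', hC', h2⟩ := ty.bdd
      refine ⟨C + C', by positivity, fun i σ x ξ => (abs_add_le _ _).trans ?_⟩
      rw [add_mul]
      exact add_le_add (h1 _ _ _ _) (h2 _ _ _ _)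

theorem Bdd.mul {w v f g : Fn I} (hf : Bdd w f) (hg : Bdd v g) :
    Bdd (fun i σ x ξ => w i σ x ξ * v i σ x ξ) (fun i σ x ξ => f i σ x ξ * g i σ x ξ) := by
  obtain ⟨C, hC, h1⟩ := hf
  obtain ⟨C', hC', h2⟩ := hg
  refine ⟨C * C', by positivity, fun i σ x ξ => ?_⟩
  rw [abs_mul, mul_mul_mul_comm]
  exact mul_le_mul (h1 _ _ _ _) (h2 _ _ _ _) (abs_nonneg _) ((abs_nonneg _).trans (h1 _ _ _ _))

theorem SymW.mul {n : ℕ} {w v f g : Fn I} (hf : SymW X Y n w f) (hg : SymW X Y n v g) :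
    SymW X Y n (fun i σ x ξ => w i σ x ξ * v i σ x ξ) (fun i σ x ξ => f i σ x ξ * g i σ x ξ) := by
  induction n generalizing w v f g with
  | zero => exact ⟨fun i => (hf.cont i).mul (hg.cont i), hf.bdd.mul hg.bdd⟩
  | succ n ih =>
    have hc : JCont (fun i σ x ξ => f i σ x ξ * g i σ x ξ) :=
      fun i => (hf.cont i).mul (hg.cont i)
    have hb := hf.bdd.mul hg.bdd
    have df := hf.down
    have dg := hg.down
    obtain ⟨_, _, fx, fy, hx, hy, sx, sy⟩ := hf
    obtain ⟨_, _, gx, gy, kx, ky, tx, ty⟩ := hg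
    refine ⟨hc, hb, _, _, fun i σ x ξ => (hx i σ x ξ).mul (kx i σ x ξ),
      fun i σ x ξ => (hy i σ x ξ).mul (ky i σ x ξ), ?_, ?_⟩
    · refine SymW.add ((ih sx dg).congr ?_ ?_) ((ih df tx).congr ?_ ?_)
      all_goals intros; ring
    · refine SymW.add ((ih sy dg).congr ?_ ?_) ((ih df ty).congr ?_ ?_)
      all_goals intros; ring

theorem SymW.zero (hX : ∀ i x ξ, 0 ≤ X i x ξ) (hY : ∀ i x ξ, 0 ≤ Y i x ξ) (n : ℕ) (w : Fn I)
    (hw : ∀ i σ x ξ, 0 ≤ w i σ x ξ) : SymW X Y n w (fun _ _ _ _ => 0) := by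
  have hc : JCont (fun (_ : I) _ _ _ => 0) := fun i => continuous_const
  have hb : Bdd w (fun _ _ _ _ => 0) := ⟨1, one_pos, fun i σ x ξ => by simpa using hw i σ x ξ⟩
  induction n generalizing w with
  | zero => exact ⟨hc, hb⟩
  | succ n ih =>
    refine ⟨hc, hb, _, _, fun i σ x ξ => hasDerivAt_const _ _,
      fun i σ x ξ => hasDerivAt_const _ _, ih _ ?_ ?_, ih _ ?_ ?_⟩
    · exact fun i σ x ξ => mul_nonneg (hw _ _ _ _) (hX _ _ _)
    · exact ⟨1, one_pos, fun i σ x ξ => by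
        simpa using mul_nonneg (hw i σ x ξ) (hX i x ξ)⟩
    · exact fun i σ x ξ => mul_nonneg (hw _ _ _ _) (hY _ _ _)
    · exact ⟨1, one_pos, fun i σ x ξ => by
        simpa using mul_nonneg (hw i σ x ξ) (hY i x ξ)⟩

theorem SymW.sigma (hX : ∀ i x ξ, 0 ≤ X i x ξ) (hY : ∀ i x ξ, 0 ≤ Y i x ξ) (n : ℕ)
    (β : ℝ → ℝ) (hβ : Continuous β) :
    SymW X Y n (fun _ σ _ _ => |β σ|) (fun _ σ _ _ => β σ) := by
  have hc : JCont (fun (_ : I) σ _ _ => β σ) := fun i => hβ.comp continuous_fst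
  have hb : Bdd (fun (_ : I) σ _ _ => |β σ|) (fun _ σ _ _ => β σ) :=
    ⟨1, one_pos, fun i σ x ξ => by simp⟩
  cases n with
  | zero => exact ⟨hc, hb⟩
  | succ n =>
    exact ⟨hc, hb, _, _, fun i σ x ξ => hasDerivAt_const _ _,
      fun i σ x ξ => hasDerivAt_const _ _,
      SymW.zero hX hY _ _ fun i σ x ξ => mul_nonneg (abs_nonneg _) (hX _ _ _),
      SymW.zero hX hY _ _ fun i σ x ξ => mul_nonneg (abs_nonneg _) (hY _ _ _)⟩

theorem SymW.smul (hX : ∀ i x ξ, 0 ≤ X i x ξ) (hY : ∀ i x ξ, 0 ≤ Y i x ξ) {n : ℕ}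
    {w f : Fn I} (hw : ∀ i σ x ξ, 0 ≤ w i σ x ξ)
    (hf : SymW X Y n w f) (c : ℝ) : SymW X Y n w (fun i σ x ξ => c * f i σ x ξ) := by
  have h := (SymW.sigma hX hY n (fun _ => c) continuous_const).mul hf
  refine h.mono hX hY (|c| + 1) (by positivity) fun i σ x ξ => ?_
  exact mul_le_mul_of_nonneg_right (by linarith) (hw _ _ _ _)

theorem SymW.inv (hX : ∀ i x ξ, 0 ≤ X i x ξ) (hY : ∀ i x ξ, 0 ≤ Y i x ξ) {n : ℕ}
    {f : Fn I} (hpos : ∀ i σ x ξ, 0 < f i σ x ξ) (hf : SymW X Y n f f) :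
    SymW X Y n (fun i σ x ξ => (f i σ x ξ)⁻¹) (fun i σ x ξ => (f i σ x ξ)⁻¹) := by
  have hc : JCont (fun i σ x ξ => (f i σ x ξ)⁻¹) :=
    fun i => (hf.cont i).inv₀ fun q => (hpos _ _ _ _).ne'
  have hb : Bdd (fun i σ x ξ => (f i σ x ξ)⁻¹) (fun i σ x ξ => (f i σ x ξ)⁻¹) :=
    ⟨1, one_pos, fun i σ x ξ => by
      rw [one_mul, abs_of_pos (inv_pos.2 (hpos i σ x ξ))]⟩
  induction n with
  | zero => exact ⟨hc, hb⟩
  | succ n ih =>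
    have hi := ih hf.down
    obtain ⟨_, _, fx, fy, hx, hy, sx, sy⟩ := hf
    refine ⟨hc, hb, _, _, fun i σ x ξ => (hx i σ x ξ).fun_inv (hpos i σ x ξ).ne',
      fun i σ x ξ => (hy i σ x ξ).fun_inv (hpos i σ x ξ).ne', ?_, ?_⟩
    · refine (((sx.mul hi).mul hi).smul hX hY ?_ (-1)).congr ?_ ?_
      · intro i σ x ξ
        have := hpos i σ x ξ
        have := hX i x ξ
        positivity
      · intro i σ x ξ
        have := (hpos i σ x ξ).ne'
        field_simp
      · intro i σ x ξ
        have := (hpos i σ x ξ).ne'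
        field_simp
    · refine (((sy.mul hi).mul hi).smul hX hY ?_ (-1)).congr ?_ ?_
      · intro i σ x ξ
        have := hpos i σ x ξ
        have := hY i x ξ
        positivity
      · intro i σ x ξ
        have := (hpos i σ x ξ).ne'
        field_simp
      · intro i σ x ξ
        have := (hpos i σ x ξ).ne'
        field_simp

end SymLemmas

theorem hasDerivAt_int (f f' : ℝ → ℝ → ℝ) (hf : Continuous fun q : ℝ × ℝ => f q.1 q.2)
    (hf' : Continuous fun q : ℝ × ℝ => f' q.1 q.2)
    (hd : ∀ σ y, HasDerivAt (f σ) (f' σ y) y) (t y : ℝ) :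
    HasDerivAt (fun y => ∫ σ in (0:ℝ)..t, f σ y) (∫ σ in (0:ℝ)..t, f' σ y) y := by
  obtain ⟨C, hC⟩ := ((isCompact_uIcc (a := (0:ℝ)) (b := t)).prod
    (isCompact_closedBall y 1)).exists_bound_of_continuousOn hf'.continuousOn
  have c1 : ∀ z, Continuous fun σ => f σ z := fun z =>
    hf.comp (continuous_id.prodMk continuous_const)
  have c2 : ∀ z, Continuous fun σ => f' σ z := fun z =>
    hf'.comp (continuous_id.prodMk continuous_const)
  refine (intervalIntegral.hasDerivAt_integral_of_dominated_loc_of_deriv_le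
    (F := fun y σ => f σ y) (F' := fun y σ => f' σ y) (bound := fun _ => C)
    (Metric.closedBall_mem_nhds y one_pos) ?_ ?_ ?_ ?_ ?_ ?_).2
  · exact Filter.Eventually.of_forall fun z => (c1 z).aestronglyMeasurable
  · exact (c1 y).intervalIntegrable _ _
  · exact (c2 y).aestronglyMeasurable
  · refine Filter.Eventually.of_forall fun σ hσ z hz => ?_
    exact hC (σ, z) ⟨uIoc_subset_uIcc hσ, hz⟩
  · exact intervalIntegrable_const
  · exact Filter.Eventually.of_forall fun σ hσ z hz => hd σ z

theorem SymW.xint {I : Type} {X Y : I → ℝ → ℝ → ℝ} (k : ℕ) {w f : Fn I} (h : SymW X Y k w f) :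
    ∃ g : Fn I, JCont g ∧ Bdd (fun i σ x ξ => w i σ x ξ * X i x ξ ^ k) g ∧
      ∀ i t ξ, iteratedDeriv k (fun x => ∫ σ in (0:ℝ)..t, f i σ x ξ) =
        fun x => ∫ σ in (0:ℝ)..t, g i σ x ξ := by
  induction k generalizing w f with
  | zero => exact ⟨f, h.cont, by simpa using h.bdd, fun i t ξ => by simp⟩
  | succ k ih =>
    have hc := h.cont
    obtain ⟨_, _, fx, fy, hx, hy, sx, sy⟩ := h
    obtain ⟨g, gc, gb, hg⟩ := ih sx
    refine ⟨g, gc, gb.mono 1 one_pos fun i σ x ξ => le_of_eq (by ring), fun i t ξ => ?_⟩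
    rw [iteratedDeriv_succ', ← hg]
    congr 1
    funext x
    refine (hasDerivAt_int (fun σ x => f i σ x ξ) (fun σ x => fx i σ x ξ) ?_ ?_
      (fun σ x => hx i σ x ξ) t x).deriv
    · exact (hc i).comp (f := fun q : ℝ × ℝ => (q.1, q.2, ξ)) (by fun_prop)
    · exact (sx.cont i).comp (f := fun q : ℝ × ℝ => (q.1, q.2, ξ)) (by fun_prop)

theorem SymW.yint {I : Type} {X Y : I → ℝ → ℝ → ℝ} (k l : ℕ) {w f : Fn I}
    (h : SymW X Y (k + l) w f) :
    ∃ g : Fn I, SymW X Y k (fun i σ x ξ => w i σ x ξ * Y i x ξ ^ l) g ∧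
      ∀ i t x, iteratedDeriv l (fun ξ => ∫ σ in (0:ℝ)..t, f i σ x ξ) =
        fun ξ => ∫ σ in (0:ℝ)..t, g i σ x ξ := by
  induction l generalizing w f with
  | zero => exact ⟨f, by simpa using h, fun i t ξ => by simp⟩
  | succ l ih =>
    have hc := h.cont
    obtain ⟨_, _, fx, fy, hx, hy, sx, sy⟩ := h
    obtain ⟨g, gs, hg⟩ := ih sy
    refine ⟨g, gs.congr (by intros; ring) (by intros; rfl), fun i t x => ?_⟩
    rw [iteratedDeriv_succ', ← hg]
    congr 1
    funext ξ
    refine (hasDerivAt_int (fun σ ξ => f i σ x ξ) (fun σ ξ => fy i σ x ξ) ?_ ?_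
      (fun σ ξ => hy i σ x ξ) t ξ).deriv
    · exact (hc i).comp (f := fun q : ℝ × ℝ => (q.1, x, q.2)) (by fun_prop)
    · exact (sy.cont i).comp (f := fun q : ℝ × ℝ => (q.1, x, q.2)) (by fun_prop)

/-- Glaeser's inequality -/
theorem glaeser (a : ℝ → ℝ) (ha : ContDiff ℝ ∞ a) (ha0 : ∀ x, 0 ≤ a x) (M : ℝ) (hM : 0 < M)
    (hb : ∀ x, |iteratedDeriv 2 a x| ≤ M) (x : ℝ) : |deriv a x| ≤ Real.sqrt (4 * M) * Real.sqrt (a x) := by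
  have h1 : ContDiff ℝ 2 a := contDiff_infty.1 ha 2
  have hda : Differentiable ℝ a := h1.differentiable (by norm_num)
  have hdd : Differentiable ℝ (deriv a) := by
    have := h1.differentiable_iteratedDeriv 1 (by norm_num)
    simpa [iteratedDeriv_one] using this
  have hL : ∀ y, |deriv a y - deriv a x| ≤ M * |y - x| := by
    intro y
    refine convex_univ.norm_image_sub_le_of_norm_deriv_le (f := deriv a) (fun z _ => hdd z) ?_
      (mem_univ x) (mem_univ y)
    intro z _
    have := hb z
    rwa [iteratedDeriv_succ, iteratedDeriv_one] at this
  have hT : ∀ y, |(a y - deriv a x * y) - (a x - deriv a x * x)| ≤ M * |y - x| * |y - x| := by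
    intro y
    refine (convex_uIcc x y).norm_image_sub_le_of_norm_hasDerivWithin_le
      (f := fun z => a z - deriv a x * z) (f' := fun z => deriv a z - deriv a x) ?_ ?_
      left_mem_uIcc right_mem_uIcc
    · intro z _
      have := (hda z).hasDerivAt.sub ((hasDerivAt_id z).const_mul (deriv a x))
      simp only [mul_one] at this
      exact this.hasDerivWithinAt
    · intro z hz
      refine (hL z).trans (mul_le_mul_of_nonneg_left ?_ hM.le)
      exact abs_sub_left_of_mem_uIcc hz
  have hk : deriv a x ^ 2 ≤ 4 * M * a x := by
    have h2 := (abs_le.1 (hT (x - deriv a x / (2 * M)))).2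
    have h3 := ha0 (x - deriv a x / (2 * M))
    have h4 : x - deriv a x / (2 * M) - x = - (deriv a x / (2 * M)) := by ring
    rw [h4, abs_neg, mul_assoc, abs_mul_abs_self] at h2
    have h5 : deriv a x = 2 * M * (deriv a x / (2 * M)) := by field_simp
    set e := deriv a x / (2 * M)
    rw [h5] at h2 ⊢
    nlinarith
  rw [← Real.sqrt_mul (by positivity)]
  exact Real.abs_le_sqrt hk

/-- the parameter range of `μ` -/
abbrev IM := Ioc (0:ℝ) 1

theorem one_le_br (μ : IM) (ξ : ℝ) : 1 ≤ br μ ξ := by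
  unfold br
  rw [Real.one_le_sqrt]
  have h : 1 ≤ (μ : ℝ)⁻¹ := (one_le_inv₀ μ.2.1).2 μ.2.2
  nlinarith [sq_nonneg ξ]

theorem br_pos (μ : IM) (ξ : ℝ) : 0 < br μ ξ := lt_of_lt_of_le one_pos (one_le_br μ ξ)

theorem abs_le_br (μ ξ : ℝ) : |ξ| ≤ br μ ξ := by
  unfold br
  exact Real.abs_le_sqrt (by nlinarith [sq_nonneg μ⁻¹])

theorem br_deriv (μ : IM) (ξ : ℝ) : HasDerivAt (fun y => br μ y) (ξ * (br μ ξ)⁻¹) ξ := by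
  have hp := br_pos μ ξ
  have h0 : (μ : ℝ)⁻¹ ^ 2 + ξ ^ 2 ≠ 0 := by
    intro h
    unfold br at hp
    rw [h] at hp
    simp at hp
  have h := (((hasDerivAt_id ξ).pow 2).const_add ((μ : ℝ)⁻¹ ^ 2)).sqrt h0
  refine (h.congr_deriv ?_)
  unfold br
  simp only [id]
  field_simp
  simp

theorem br_cont (μ : ℝ) : Continuous fun y => br μ y := by
  unfold br
  fun_prop

section Spec

variable {X : IM → ℝ → ℝ → ℝ}

/-- the cost of a `ξ`-derivative -/
noncomputable def YY : IM → ℝ → ℝ → ℝ := fun μ _ ξ => (br μ ξ)⁻¹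

theorem YY_nonneg (μ : IM) (x ξ : ℝ) : 0 ≤ YY μ x ξ := (inv_pos.2 (br_pos μ ξ)).le

theorem symW_xi (hX : ∀ i x ξ, 0 ≤ X i x ξ) (n : ℕ) :
    SymW X YY n (fun μ _ _ ξ => br μ ξ) (fun _ _ _ ξ => ξ) := by
  have hc : JCont (fun (_ : IM) _ _ ξ => ξ) := fun i => by fun_prop
  have hb : Bdd (fun (μ : IM) _ _ ξ => br μ ξ) (fun _ _ _ ξ => ξ) :=
    ⟨1, one_pos, fun i σ x ξ => by simpa using abs_le_br i ξ⟩
  cases n with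
  | zero => exact ⟨hc, hb⟩
  | succ n =>
    refine ⟨hc, hb, _, _, fun i σ x ξ => hasDerivAt_const _ _, fun i σ x ξ => hasDerivAt_id _,
      SymW.zero hX YY_nonneg _ _ fun i σ x ξ => mul_nonneg (br_pos i ξ).le (hX _ _ _),
      (SymW.sigma hX YY_nonneg n (fun _ => 1) continuous_const).congr ?_ ?_⟩
    · intro i σ x ξ
      simp [YY, (br_pos i ξ).ne']
    · intros; rfl

theorem symW_br (hX : ∀ i x ξ, 0 ≤ X i x ξ) (n : ℕ) (p : ℝ) :
    SymW X YY n (fun μ _ _ ξ => br μ ξ ^ p) (fun μ _ _ ξ => br μ ξ ^ p) := by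
  have hc : JCont (fun (μ : IM) _ _ ξ => br μ ξ ^ p) := fun i =>
    ((br_cont i).comp (by fun_prop : Continuous fun q : ℝ × ℝ × ℝ => q.2.2)).rpow_const
      fun q => Or.inl (br_pos i _).ne'
  have hb : Bdd (fun (μ : IM) _ _ ξ => br μ ξ ^ p) (fun μ _ _ ξ => br μ ξ ^ p) :=
    ⟨1, one_pos, fun i σ x ξ => by
      rw [one_mul, abs_of_pos (Real.rpow_pos_of_pos (br_pos i ξ) p)]⟩
  induction n generalizing p with
  | zero => exact ⟨hc, hb⟩
  | succ n ih =>
    refine ⟨hc, hb, _, _, fun i σ x ξ => hasDerivAt_const _ _,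
      fun i σ x ξ => (br_deriv i ξ).rpow_const (p := p) (Or.inl (br_pos i ξ).ne'),
      SymW.zero hX YY_nonneg _ _ fun i σ x ξ =>
        mul_nonneg (Real.rpow_pos_of_pos (br_pos i ξ) p).le (hX _ _ _), ?_⟩
    have h1 : SymW X YY n (fun μ _ _ ξ => br μ ξ ^ (p - 2)) (fun μ _ _ ξ => br μ ξ ^ (p - 2)) := by
      apply ih
      · exact fun i =>
          ((br_cont i).comp (by fun_prop : Continuous fun q : ℝ × ℝ × ℝ => q.2.2)).rpow_const
            fun q => Or.inl (br_pos i _).ne'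
      · exact ⟨1, one_pos, fun i σ x ξ => by
          rw [one_mul, abs_of_pos (Real.rpow_pos_of_pos (br_pos i ξ) _)]⟩
    have hmul : ∀ (i : IM) ξ, br i ξ ^ (p - 2) = br i ξ ^ p * (br i ξ)⁻¹ * (br i ξ)⁻¹ := by
      intro i ξ
      rw [Real.rpow_sub (br_pos i ξ), Real.rpow_two]
      field_simp
    refine (((symW_xi hX n).mul h1).smul hX YY_nonneg ?_ p).congr ?_ ?_
    · intro i σ x ξ
      exact mul_nonneg (br_pos i ξ).le (Real.rpow_pos_of_pos (br_pos i ξ) _).le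
    · intro i σ x ξ
      have := (br_pos i ξ).ne'
      simp only [hmul, YY]
      field_simp
    · intro i σ x ξ
      have := (br_pos i ξ).ne'
      simp only [hmul, Real.rpow_sub_one this]
      field_simp

end Spec

section Main

variable (a : ℝ → ℝ) (δ : ℝ)

/-- the cost of an `x`-derivative -/
noncomputable def XX : IM → ℝ → ℝ → ℝ := fun μ x ξ => (Real.sqrt (phi a δ μ x ξ))⁻¹

theorem XX_nonneg (μ : IM) (x ξ : ℝ) : 0 ≤ XX a δ μ x ξ := by unfold XX; positivity

theorem w_pos (μ : IM) (ξ : ℝ) : 0 < br μ ξ ^ (-(2*δ)) := Real.rpow_pos_of_pos (br_pos μ ξ) _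

theorem phi_pos (ha0 : ∀ x, 0 ≤ a x) (μ : IM) (x ξ : ℝ) : 0 < phi a δ μ x ξ :=
  add_pos_of_nonneg_of_pos (ha0 x) (w_pos δ μ ξ)

theorem w_le_one (hδ0 : 0 ≤ δ) (μ : IM) (ξ : ℝ) : br μ ξ ^ (-(2*δ)) ≤ 1 :=
  Real.rpow_le_one_of_one_le_of_nonpos (one_le_br μ ξ) (by linarith)

theorem symW_a (s : ℝ) (hδ0 : 0 ≤ δ) (ha : Gevrey s a) (ha0 : ∀ x, 0 ≤ a x) (n k : ℕ) :
    SymW (XX a δ) YY n (fun μ _ x ξ => phi a δ μ x ξ * XX a δ μ x ξ ^ k)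
      (fun _ _ x _ => iteratedDeriv k a x) := by
  obtain ⟨hs, C₀, A₀, hC, hA, hbd⟩ := ha
  have hdiff : ∀ k, Differentiable ℝ (iteratedDeriv k a) := fun k =>
    hs.differentiable_iteratedDeriv k (by exact_mod_cast WithTop.coe_lt_top _)
  have hcont : ∀ k, JCont (fun (_ : IM) _ x _ => iteratedDeriv k a x) := fun k i =>
    (hdiff k).continuous.comp (by fun_prop : Continuous fun q : ℝ × ℝ × ℝ => q.2.1)
  have hbb : ∀ k, Bdd (fun (μ : IM) _ x ξ => phi a δ μ x ξ * XX a δ μ x ξ ^ k)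
      (fun (_ : IM) _ x _ => iteratedDeriv k a x) := by
    intro k
    match k with
    | 0 =>
      refine ⟨1, one_pos, fun i σ x ξ => ?_⟩
      simp only [iteratedDeriv_zero, pow_zero, mul_one, one_mul, abs_of_nonneg (ha0 x), phi]
      linarith [w_pos δ i ξ]
    | 1 =>
      have hM : 0 < C₀ * A₀ ^ 2 * ((2:ℕ).factorial : ℝ) ^ s := by positivity
      refine ⟨Real.sqrt (4 * (C₀ * A₀ ^ 2 * ((2:ℕ).factorial : ℝ) ^ s)), by positivity,
        fun i σ x ξ => ?_⟩
      rw [iteratedDeriv_one]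
      refine (glaeser a hs ha0 _ hM (fun y => hbd y 2) x).trans ?_
      refine mul_le_mul_of_nonneg_left ?_ (Real.sqrt_nonneg _)
      have hp := phi_pos a δ ha0 i x ξ
      have : phi a δ i x ξ * XX a δ i x ξ ^ 1 = Real.sqrt (phi a δ i x ξ) := by
        unfold XX
        rw [pow_one, ← div_eq_mul_inv, Real.div_sqrt]
      beta_reduce
      rw [this]
      apply Real.sqrt_le_sqrt
      unfold phi
      linarith [w_pos δ i ξ]
    | k + 2 =>
      have h0 : 0 < C₀ * A₀ ^ (k+2) * ((k+2).factorial : ℝ) ^ s := by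
        have : (0:ℝ) < ((k+2).factorial : ℝ) := by exact_mod_cast Nat.factorial_pos _
        positivity
      -- upper bound for `φ`
      have hM0 : 0 < C₀ * A₀ ^ 0 * ((0:ℕ).factorial : ℝ) ^ s + 1 := by positivity
      set M := C₀ * A₀ ^ 0 * ((0:ℕ).factorial : ℝ) ^ s + 1 with hMdef
      have hphi : ∀ (i : IM) x ξ, phi a δ i x ξ ≤ M := by
        intro i x ξ
        have h1 := (le_abs_self _).trans (hbd x 0)
        rw [iteratedDeriv_zero] at h1
        exact add_le_add h1 (w_le_one δ hδ0 i ξ)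
      refine ⟨C₀ * A₀ ^ (k+2) * ((k+2).factorial : ℝ) ^ s * Real.sqrt M ^ k, by positivity,
        fun i σ x ξ => (hbd x (k+2)).trans ?_⟩
      rw [mul_assoc _ (Real.sqrt M ^ k)]
      refine le_mul_of_one_le_right h0.le ?_
      have hp := phi_pos a δ ha0 i x ξ
      have hsp := Real.sqrt_pos.2 hp
      have : phi a δ i x ξ * XX a δ i x ξ ^ (k+2) = XX a δ i x ξ ^ k := by
        have h2 : XX a δ i x ξ ^ 2 = (phi a δ i x ξ)⁻¹ := by
          unfold XX
          rw [inv_pow, Real.sq_sqrt hp.le]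
        rw [pow_add, h2]
        field_simp
      beta_reduce
      rw [this, ← mul_pow]
      apply one_le_pow₀
      unfold XX
      rw [← div_eq_mul_inv, one_le_div hsp]
      exact Real.sqrt_le_sqrt (hphi i x ξ)
  induction n generalizing k with
  | zero => exact ⟨hcont k, hbb k⟩
  | succ n ih =>
    refine ⟨hcont k, hbb k, fun _ _ x _ => iteratedDeriv (k+1) a x, _, fun i σ x ξ => ?_,
      fun i σ x ξ => hasDerivAt_const _ _, (ih (k+1)).congr ?_ ?_,
      SymW.zero (XX_nonneg a δ) YY_nonneg _ _ fun i σ x ξ => ?_⟩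
    · rw [iteratedDeriv_succ]
      exact (hdiff k x).hasDerivAt
    · intros; ring
    · intros; rfl
    · have := phi_pos a δ ha0 i x ξ
      have := XX_nonneg a δ i x ξ
      have := YY_nonneg i x ξ
      positivity

theorem symW_phi (s : ℝ) (hδ0 : 0 ≤ δ) (ha : Gevrey s a) (ha0 : ∀ x, 0 ≤ a x) (n : ℕ) :
    SymW (XX a δ) YY n (fun μ _ x ξ => phi a δ μ x ξ) (fun μ _ x ξ => phi a δ μ x ξ) := by
  refine SymW.add (f := fun (_ : IM) _ x _ => a x) (g := fun (μ : IM) _ _ ξ => br μ ξ ^ (-(2*δ))) ?_ ?_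
  · exact (symW_a a δ s hδ0 ha ha0 n 0).congr (by intros; simp) (by intros; simp)
  · refine (symW_br (XX_nonneg a δ) n (-(2*δ))).mono (XX_nonneg a δ) YY_nonneg 1 one_pos ?_
    intro i σ x ξ
    have := ha0 x
    unfold phi
    linarith

theorem symW_F (s : ℝ) (hδ0 : 0 ≤ δ) (ha : Gevrey s a) (ha0 : ∀ x, 0 ≤ a x)
    (B β : ℝ → ℝ) (hB : Continuous B) (hβ : Continuous β) (hB0 : ∀ σ, 0 ≤ B σ)
    (hβ0 : ∀ σ, 0 ≤ β σ) (n : ℕ) :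
    SymW (XX a δ) YY n
      (fun μ σ x ξ => β σ * phi a δ μ x ξ / (B σ * phi a δ μ x ξ + br μ ξ ^ (-(2*δ))))
      (fun μ σ x ξ => β σ * phi a δ μ x ξ / (B σ * phi a δ μ x ξ + br μ ξ ^ (-(2*δ)))) := by
  have hX := XX_nonneg a δ
  have hphi := symW_phi a δ s hδ0 ha ha0 n
  have hBphi := (SymW.sigma hX YY_nonneg n B hB).mul hphi
  have hβphi := (SymW.sigma hX YY_nonneg n β hβ).mul hphi
  have hw := symW_br hX n (-(2*δ))
  have hD : SymW (XX a δ) YY n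
      (fun μ σ x ξ => B σ * phi a δ μ x ξ + br μ ξ ^ (-(2*δ)))
      (fun μ σ x ξ => B σ * phi a δ μ x ξ + br μ ξ ^ (-(2*δ))) := by
    refine SymW.add (hBphi.mono hX YY_nonneg 1 one_pos ?_) (hw.mono hX YY_nonneg 1 one_pos ?_)
    · intro i σ x ξ
      rw [abs_of_nonneg (hB0 σ)]
      linarith [w_pos δ i ξ]
    · intro i σ x ξ
      have := mul_nonneg (hB0 σ) (phi_pos a δ ha0 i x ξ).le
      linarith
  have hDi := hD.inv hX YY_nonneg fun i σ x ξ =>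
    add_pos_of_nonneg_of_pos (mul_nonneg (hB0 σ) (phi_pos a δ ha0 i x ξ).le) (w_pos δ i ξ)
  refine (hβphi.mul hDi).congr ?_ ?_
  · intro i σ x ξ
    rw [abs_of_nonneg (hβ0 σ), div_eq_mul_inv]
  · intro i σ x ξ
    rw [div_eq_mul_inv]

end Main

theorem stmt13 (T : ℝ) (hT : 0 < T)
    (b : ℝ → ℝ) (hb : ContDiffOn ℝ 1 b (Icc 0 T)) (hb0 : ∀ t ∈ Icc (0:ℝ) T, 0 ≤ b t)
    (s δ : ℝ) (hs : 1 < s) (hδ0 : 0 ≤ δ) (hδ1 : δ < 1)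
    (a : ℝ → ℝ) (ha : Gevrey s a) (ha0 : ∀ x, 0 ≤ a x) :
    ∀ k l : ℕ, ∃ C : ℝ, 0 < C ∧
      ∀ (μ t x ξ : ℝ), 0 < μ → μ ≤ 1 → t ∈ Icc (0:ℝ) T →
        |pdXxi k l (fun x' ξ' => Lam b a T δ μ t x' ξ') x ξ| ≤
          C * Lam b a T δ μ t x ξ * phi a δ μ x ξ ^ (-(k : ℝ)/2) * br μ ξ ^ (-(l : ℝ)) := by

  intro k l
  have h0T : (0:ℝ) ≤ T := hT.le
  have hbc : ContinuousOn b (Icc 0 T) := hb.continuousOn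
  have hb'c : ContinuousOn (derivWithin b (Icc 0 T)) (Icc 0 T) :=
    hb.continuousOn_derivWithin (uniqueDiffOn_Icc hT) le_rfl
  set B : ℝ → ℝ := fun σ => b (projIcc 0 T h0T σ) with hBdef
  set β : ℝ → ℝ := fun σ => |derivWithin b (Icc 0 T) (projIcc 0 T h0T σ)| with hβdef
  have hB : Continuous B := hbc.comp_continuous
    (continuous_subtype_val.comp continuous_projIcc) fun σ => (projIcc 0 T h0T σ).2
  have hβ : Continuous β := (hb'c.comp_continuous
    (continuous_subtype_val.comp continuous_projIcc) fun σ => (projIcc 0 T h0T σ).2).abs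
  have hB0 : ∀ σ, 0 ≤ B σ := fun σ => hb0 _ (projIcc 0 T h0T σ).2
  have hF := symW_F a δ s hδ0 ha ha0 B β hB hβ hB0 (fun σ => abs_nonneg _) (k + l)
  set F : Fn IM := fun μ σ x ξ =>
    β σ * phi a δ μ x ξ / (B σ * phi a δ μ x ξ + br μ ξ ^ (-(2*δ))) with hFdef
  have hLam : ∀ (μ : IM) t, t ∈ Icc (0:ℝ) T → ∀ x ξ,
      Lam b a T δ μ t x ξ = ∫ σ in (0:ℝ)..t, F μ σ x ξ := by
    intro μ t ht x ξ
    unfold Lam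
    apply intervalIntegral.integral_congr
    intro σ hσ
    rw [uIcc_of_le ht.1] at hσ
    have hm : σ ∈ Icc (0:ℝ) T := ⟨hσ.1, hσ.2.trans ht.2⟩
    simp only [hFdef, hBdef, hβdef, projIcc_of_mem h0T hm]
  obtain ⟨g, gs, hg⟩ := SymW.yint k l hF
  obtain ⟨g', gc', ⟨C, hC, gb'⟩, hg'⟩ := SymW.xint k gs
  refine ⟨C, hC, fun μ t x ξ hμ0 hμ1 ht => ?_⟩
  have hL := hLam ⟨μ, hμ0, hμ1⟩ t ht
  have hgy := hg ⟨μ, hμ0, hμ1⟩ t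
  have hgx := hg' ⟨μ, hμ0, hμ1⟩ t
  have hbd := gb' ⟨μ, hμ0, hμ1⟩
  have hFc := hF.cont ⟨μ, hμ0, hμ1⟩
  have hphi := phi_pos a δ ha0 ⟨μ, hμ0, hμ1⟩ x ξ
  have hbr := br_pos ⟨μ, hμ0, hμ1⟩ ξ
  simp only [XX, YY] at hbd
  simp only at hL hphi hbr
  have e1 : pdXxi k l (fun x' ξ' => Lam b a T δ μ t x' ξ') x ξ =
      ∫ σ in (0:ℝ)..t, g' ⟨μ, hμ0, hμ1⟩ σ x ξ := by
    unfold pdXxi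
    simp only [hL, hgy, hgx]
  have e2 : phi a δ μ x ξ ^ (-(k : ℝ)/2) = (Real.sqrt (phi a δ μ x ξ))⁻¹ ^ k := by
    rw [Real.sqrt_eq_rpow, ← Real.rpow_neg hphi.le, ← Real.rpow_natCast, ← Real.rpow_mul hphi.le]
    congr 1
    ring
  have e3 : br μ ξ ^ (-(l : ℝ)) = (br μ ξ)⁻¹ ^ l := by
    rw [Real.rpow_neg hbr.le, Real.rpow_natCast, inv_pow]
  have hFc1 : Continuous fun σ => F ⟨μ, hμ0, hμ1⟩ σ x ξ :=
    hFc.comp (f := fun σ : ℝ => (σ, x, ξ)) (by fun_prop)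
  rw [e1, e2, e3, hL]
  refine (intervalIntegral.norm_integral_le_of_norm_le
    (f := fun σ => g' ⟨μ, hμ0, hμ1⟩ σ x ξ) (g := fun σ => C * (F ⟨μ, hμ0, hμ1⟩ σ x ξ *
      (br μ ξ)⁻¹ ^ l * (Real.sqrt (phi a δ μ x ξ))⁻¹ ^ k)) ht.1
    (Filter.Eventually.of_forall fun σ _ => hbd σ x ξ) ?_).trans (le_of_eq ?_)
  · exact (((hFc1.mul_const _).mul_const _).const_mul C).intervalIntegrable _ _
  · simp only [intervalIntegral.integral_const_mul, intervalIntegral.integral_mul_const]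
    ring
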